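/- arXiv:1511.06937 — 2 statements merged into one kernel-verified Lean document; each statement's English description precedes it below -/
import Mathlib

section
/- Let a > 0 and κ > 0, and let φ : ℝ³ → ℝ be smooth and supported in {y : |y|_∞ ≤ 1/4}. Then the operator a − Δ^ε on ℝ^{𝕋³_ε} is symmetric and positive definite with respect to ⟨·,·⟩_ε (in particular invertible), and there exists a constant C, depending only on a, κ and φ, such that for every N ∈ ℕ, ε = 2^{-N}, every ν ∈ [ε,1] and every x ∈ 𝕋³_ε, one has ⟨φ_x^ν, (a − Δ^ε)^{−1} φ_x^ν⟩_ε ≤ C ν^{−1−κ}, where φ_x^ν(y) := ν^{−3} φ((y−x)/ν) is regarded as a function on 𝕋³_ε by choosing the representative of y − x in [−1/2,1/2)³. -/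
noncomputable section

open scoped BigOperators

/-- The dyadic discrete three-dimensional torus `𝕋³_ε = (εℤ/ℤ)³`, `ε = 2^{-N}`. -/
abbrev Tor (N : ℕ) := Fin 3 → ZMod (2^N)

/-- The inner product `⟨f,g⟩_ε = ε³ Σ_{x∈𝕋³_ε} f(x)g(x)`. -/
def torInner (N : ℕ) (f g : Tor N → ℝ) : ℝ :=
  (((2:ℝ)^N)⁻¹)^3 * ∑ x : Tor N, f x * g x

/-- The nearest-neighbour discrete Laplacian on `𝕋³_ε`. -/
def discLap (N : ℕ) (f : Tor N → ℝ) : Tor N → ℝ :=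
  fun x => ((2:ℝ)^N)^2 * ∑ i : Fin 3,
    (f (x + Pi.single i 1) + f (x - Pi.single i 1) - 2 * f x)

/-- The representative in `[−1/2, 1/2)` of a point of `εℤ/ℤ`. -/
def torRep (N : ℕ) (m : ZMod (2^N)) : ℝ :=
  if (m.val : ℝ) * ((2:ℝ)^N)⁻¹ < 1/2 then (m.val : ℝ) * ((2:ℝ)^N)⁻¹
  else (m.val : ℝ) * ((2:ℝ)^N)⁻¹ - 1

/-- The rescaled test function `φ_x^ν(y) = ν^{−3} φ((y−x)/ν)` regarded as a function on
`𝕋³_ε` through the representative of `y − x` in `[−1/2,1/2)³`. -/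
def torTest (N : ℕ) (φ : (Fin 3 → ℝ) → ℝ) (ν : ℝ) (x : Tor N) : Tor N → ℝ :=
  fun y => (ν^3)⁻¹ * φ (fun i => torRep N (y i - x i) / ν)

section Shift

variable {T : Type*} [AddCommGroup T] [Fintype T]

theorem sum_add_right_eq (F : T → ℝ) (e : T) : ∑ y, F (y + e) = ∑ y, F y :=
  Equiv.sum_comp (Equiv.addRight e) F

theorem sum_sub_shift_mul (V W : T → ℝ) (e : T) :
    ∑ y, (V y - V (y - e)) * W y = ∑ y, V y * (W y - W (y + e)) := by
  have h := sum_add_right_eq (fun y => V (y - e) * W y) e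
  simp only [add_sub_cancel_right] at h
  simp only [sub_mul, mul_sub, Finset.sum_sub_distrib, h]

theorem sum_second_difference_mul (f g : T → ℝ) (e : T) :
    ∑ y, (f (y + e) + f (y - e) - 2 * f y) * g y =
      -∑ y, (f (y + e) - f y) * (g (y + e) - g y) := by
  have h := sum_sub_shift_mul (fun y => f (y + e) - f y) g e
  simp only [sub_add_cancel] at h
  rw [← Finset.sum_neg_distrib]
  convert h using 1
  · exact Finset.sum_congr rfl fun y _ => by ring
  · exact Finset.sum_congr rfl fun y _ => by ring

end Shift

/-- The unscaled Dirichlet form on the discrete torus. -/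
def dirichletForm (N : ℕ) (f g : Tor N → ℝ) : ℝ :=
  ∑ i : Fin 3, ∑ y : Tor N, (f (y + Pi.single i 1) - f y) * (g (y + Pi.single i 1) - g y)

theorem dirichletForm_comm (N : ℕ) (f g : Tor N → ℝ) :
    dirichletForm N f g = dirichletForm N g f :=
  Finset.sum_congr rfl fun _ _ => Finset.sum_congr rfl fun _ _ => mul_comm _ _

theorem dirichletForm_self_nonneg (N : ℕ) (f : Tor N → ℝ) : 0 ≤ dirichletForm N f f :=
  Finset.sum_nonneg fun _ _ => Finset.sum_nonneg fun _ _ => mul_self_nonneg _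

theorem torInner_comm (N : ℕ) (f g : Tor N → ℝ) : torInner N f g = torInner N g f := by
  simp only [torInner, mul_comm]

theorem torInner_resolvent (N : ℕ) (a : ℝ) (f g : Tor N → ℝ) :
    torInner N (fun x => a * f x - discLap N f x) g =
      (((2:ℝ)^N)⁻¹)^3 * (a * ∑ x, f x * g x + ((2:ℝ)^N)^2 * dirichletForm N f g) := by
  have h : ∑ x, discLap N f x * g x = -(((2:ℝ)^N)^2 * dirichletForm N f g) := by
    simp only [discLap, dirichletForm, mul_assoc]
    rw [← Finset.mul_sum, ← mul_neg, ← Finset.sum_neg_distrib]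
    simp only [Finset.sum_mul]
    rw [Finset.sum_comm]
    simp only [sum_second_difference_mul]
  simp only [torInner, sub_mul, Finset.sum_sub_distrib, h, Finset.mul_sum, mul_assoc, sub_neg_eq_add]

theorem torInner_resolvent_symm (N : ℕ) (a : ℝ) (f g : Tor N → ℝ) :
    torInner N (fun x => a * f x - discLap N f x) g =
      torInner N f (fun x => a * g x - discLap N g x) := by
  rw [torInner_comm N f, torInner_resolvent, torInner_resolvent, dirichletForm_comm]
  simp only [mul_comm (f _)]

theorem torInner_resolvent_pos (N : ℕ) {a : ℝ} (ha : 0 < a) {f : Tor N → ℝ} (hf : f ≠ 0) :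
    0 < torInner N (fun x => a * f x - discLap N f x) f := by
  rw [torInner_resolvent]
  obtain ⟨x, hx⟩ := Function.ne_iff.mp hf
  have h : 0 < ∑ x, f x * f x :=
    Finset.sum_pos' (fun _ _ => mul_self_nonneg _) ⟨x, Finset.mem_univ _, mul_self_pos.mpr hx⟩
  have := dirichletForm_self_nonneg N f
  positivity

theorem resolvent_bijective (N : ℕ) {a : ℝ} (ha : 0 < a) :
    Function.Bijective (fun f : Tor N → ℝ => fun x => a * f x - discLap N f x) := by
  let A : (Tor N → ℝ) →ₗ[ℝ] (Tor N → ℝ) :=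
    { toFun := fun f x => a * f x - discLap N f x
      map_add' := fun f g => by
        funext x
        simp only [discLap, Pi.add_apply, Fin.sum_univ_three]
        ring
      map_smul' := fun r f => by
        funext x
        simp only [discLap, Pi.smul_apply, smul_eq_mul, Fin.sum_univ_three, RingHom.id_apply]
        ring }
  have hinj : Function.Injective A := by
    refine (injective_iff_map_eq_zero A).mpr fun f hf => ?_
    by_contra hne
    have hpos := torInner_resolvent_pos N ha hne
    have h0 : (fun x => a * f x - discLap N f x) = 0 := hf
    rw [h0] at hpos
    simp [torInner] at hpos
  exact ⟨hinj, LinearMap.injective_iff_surjective.mp hinj⟩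

section Chord

variable (n : ℕ) [NeZero n]

/-- The squared chord length `|e^{2πim/n} - 1|²`. -/
def chordSq (m : ZMod n) : ℝ := 2 - 2 * (ZMod.stdAddChar m : ℂ).re

variable {n}

theorem re_sq_add_im_sq_stdAddChar (m : ZMod n) :
    (ZMod.stdAddChar m : ℂ).re ^ 2 + (ZMod.stdAddChar m : ℂ).im ^ 2 = 1 := by
  have h : ‖(ZMod.stdAddChar m : ℂ)‖ = 1 := by
    rw [ZMod.stdAddChar_apply]; exact Circle.norm_coe _
  rw [Complex.norm_eq_sqrt_sq_add_sq, Real.sqrt_eq_one] at h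
  exact h

theorem chordSq_nonneg (m : ZMod n) : 0 ≤ chordSq n m := by
  have := re_sq_add_im_sq_stdAddChar m
  unfold chordSq
  nlinarith [sq_nonneg (ZMod.stdAddChar m : ℂ).im]

theorem chordSq_add_one_add_chordSq_sub_one (m : ZMod n) :
    (chordSq n (m + 1) - chordSq n m) - (chordSq n m - chordSq n (m - 1)) =
      chordSq n 1 * (2 - chordSq n m) := by
  have h1 := re_sq_add_im_sq_stdAddChar (1 : ZMod n)
  have hadd : (ZMod.stdAddChar (m + 1) : ℂ) = ZMod.stdAddChar m * ZMod.stdAddChar (1 : ZMod n) :=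
    AddChar.map_add_eq_mul _ _ _
  have hsub : (ZMod.stdAddChar m : ℂ) = ZMod.stdAddChar (m - 1) * ZMod.stdAddChar (1 : ZMod n) := by
    rw [← AddChar.map_add_eq_mul, sub_add_cancel]
  have hsub' : (ZMod.stdAddChar (m - 1) : ℂ).re =
      (ZMod.stdAddChar m : ℂ).re * (ZMod.stdAddChar (1 : ZMod n)).re +
      (ZMod.stdAddChar m : ℂ).im * (ZMod.stdAddChar (1 : ZMod n)).im := by
    rw [hsub, Complex.mul_re, Complex.mul_im]
    linear_combination -(ZMod.stdAddChar (m - 1) : ℂ).re * h1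
  simp only [chordSq, hadd, hsub', Complex.mul_re]
  ring

theorem sq_chordSq_add_one_sub_le (m : ZMod n) :
    (chordSq n (m + 1) - chordSq n m) ^ 2 ≤
      22 / 5 * chordSq n 1 * chordSq n m + 11 * chordSq n 1 ^ 2 := by
  have h1 := re_sq_add_im_sq_stdAddChar (1 : ZMod n)
  have hm := re_sq_add_im_sq_stdAddChar m
  have hadd : (ZMod.stdAddChar (m + 1) : ℂ) = ZMod.stdAddChar m * ZMod.stdAddChar (1 : ZMod n) :=
    AddChar.map_add_eq_mul _ _ _
  simp only [chordSq, hadd, Complex.mul_re]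
  generalize (ZMod.stdAddChar m : ℂ).re = c at *
  generalize (ZMod.stdAddChar m : ℂ).im = s at *
  generalize (ZMod.stdAddChar (1 : ZMod n) : ℂ).re = C at *
  generalize (ZMod.stdAddChar (1 : ZMod n) : ℂ).im = S at *
  have hs : s ^ 2 ≤ 2 - 2 * c := by nlinarith [sq_nonneg (1 - c)]
  have hS : S ^ 2 ≤ 2 - 2 * C := by nlinarith [sq_nonneg (1 - C)]
  have hc : c ^ 2 ≤ 1 := by nlinarith [sq_nonneg s]
  have hprod : s ^ 2 * S ^ 2 ≤ (2 - 2 * c) * (2 - 2 * C) :=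
    mul_le_mul hs hS (sq_nonneg _) ((sq_nonneg s).trans hs)
  have hc' : c ^ 2 * (2 - 2 * C) ^ 2 ≤ 1 * (2 - 2 * C) ^ 2 :=
    mul_le_mul_of_nonneg_right hc (sq_nonneg _)
  calc (2 - 2 * (c * C - s * S) - (2 - 2 * c)) ^ 2
      = (c * (2 - 2 * C) + 2 * (s * S)) ^ 2 := by ring
    _ ≤ 11 * (c ^ 2 * (2 - 2 * C) ^ 2) + 22 / 5 * (s ^ 2 * S ^ 2) := by
        nlinarith [sq_nonneg (10 * (c * (2 - 2 * C)) - 2 * (s * S))]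
    _ ≤ _ := by linarith

theorem sq_chordSq_sub_chordSq_sub_one_le (m : ZMod n) :
    (chordSq n m - chordSq n (m - 1)) ^ 2 ≤
      22 / 5 * chordSq n 1 * chordSq n m + 11 * chordSq n 1 ^ 2 := by
  have hneg : ∀ k : ZMod n, chordSq n (-k) = chordSq n k := fun k => by
    have : (ZMod.stdAddChar (-k) : ℂ) * ZMod.stdAddChar k = 1 := by
      rw [← AddChar.map_add_eq_mul, neg_add_cancel, AddChar.map_zero_eq_one]
    have hk := re_sq_add_im_sq_stdAddChar k
    have hre := congrArg Complex.re this
    have him := congrArg Complex.im this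
    simp only [Complex.mul_re, Complex.mul_im, Complex.one_re, Complex.one_im] at hre him
    unfold chordSq
    linear_combination 2 * (ZMod.stdAddChar (-k) : ℂ).re * hk -
      2 * (ZMod.stdAddChar k : ℂ).re * hre - 2 * (ZMod.stdAddChar k : ℂ).im * him
  have h := sq_chordSq_add_one_sub_le (-m)
  rw [show -m + 1 = -(m - 1) by ring, hneg, hneg] at h
  linarith [sub_sq_comm (chordSq n m) (chordSq n (m - 1))]

theorem chordSq_eq_cos (m : ZMod n) :
    chordSq n m = 2 - 2 * Real.cos (2 * Real.pi * (m.val / n)) := by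
  have h : (ZMod.stdAddChar m : ℂ) = Complex.exp (((2 * Real.pi * (m.val / n) : ℝ) : ℂ) * Complex.I) := by
    rw [ZMod.stdAddChar_apply, ZMod.toCircle_apply]
    congr 1
    push_cast
    ring
  rw [chordSq, h, Complex.exp_ofReal_mul_I_re]

theorem chordSq_one_eq_cos : chordSq n 1 = 2 - 2 * Real.cos (2 * Real.pi / n) := by
  have h : (ZMod.stdAddChar (1 : ZMod n) : ℂ) =
      Complex.exp (((2 * Real.pi / n : ℝ) : ℂ) * Complex.I) := by
    have := ZMod.stdAddChar_coe (N := n) 1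
    rw [Int.cast_one] at this
    rw [this]
    congr 1
    push_cast
    ring
  rw [chordSq, h, Complex.exp_ofReal_mul_I_re]

theorem chordSq_one_le : chordSq n 1 ≤ (2 * Real.pi / n) ^ 2 := by
  rw [chordSq_one_eq_cos]
  linarith [Real.one_sub_sq_div_two_le_cos (x := 2 * Real.pi / n)]

theorem le_chordSq_one (hn : 2 ≤ n) : 16 / (n : ℝ) ^ 2 ≤ chordSq n 1 := by
  have hn' : (2 : ℝ) ≤ n := by exact_mod_cast hn
  have hpi := Real.pi_pos
  have hx : |2 * Real.pi / n| ≤ Real.pi := by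
    rw [abs_of_nonneg (by positivity), div_le_iff₀ (by positivity)]
    nlinarith
  have h := Real.cos_le_one_sub_mul_cos_sq hx
  rw [chordSq_one_eq_cos]
  have : 2 / Real.pi ^ 2 * (2 * Real.pi / n) ^ 2 = 8 / (n : ℝ) ^ 2 := by
    field_simp
    norm_num
  rw [this] at h
  linarith [show 16 / (n : ℝ) ^ 2 = 2 * (8 / (n : ℝ) ^ 2) by ring]

end Chord

theorem chordSq_le_torRep_sq (N : ℕ) (m : ZMod (2 ^ N)) :
    chordSq (2 ^ N) m ≤ (2 * Real.pi * torRep N m) ^ 2 := by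
  have h : chordSq (2 ^ N) m = 2 - 2 * Real.cos (2 * Real.pi * torRep N m) := by
    rw [chordSq_eq_cos, torRep]
    push_cast
    split_ifs
    · rfl
    · rw [← Real.cos_sub_two_pi]
      congr 3
      ring
  rw [h]
  linarith [Real.one_sub_sq_div_two_le_cos (x := 2 * Real.pi * torRep N m)]

/-- A regularised squared distance to `x` on the discrete torus. -/
def distWeight (N : ℕ) (b : ℝ) (x y : Tor N) : ℝ := b + ∑ i, chordSq (2 ^ N) (y i - x i)

section Weight

variable {N : ℕ} {b : ℝ}

theorem distWeight_pos (hb : 0 < b) (x y : Tor N) : 0 < distWeight N b x y :=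
  add_pos_of_pos_of_nonneg hb (Finset.sum_nonneg fun _ _ => chordSq_nonneg _)

theorem add_chordSq_le_distWeight (x y : Tor N) (i : Fin 3) :
    b + chordSq (2 ^ N) (y i - x i) ≤ distWeight N b x y := by
  have := Finset.single_le_sum (f := fun i => chordSq (2 ^ N) (y i - x i))
    (fun _ _ => chordSq_nonneg _) (Finset.mem_univ i)
  unfold distWeight
  linarith

theorem distWeight_add_single (x y : Tor N) (i : Fin 3) (t : ZMod (2 ^ N)) :
    distWeight N b x (y + Pi.single i t) - distWeight N b x y =
      chordSq (2 ^ N) (y i - x i + t) - chordSq (2 ^ N) (y i - x i) := by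
  fin_cases i <;> simp [distWeight, Fin.sum_univ_three, add_sub_right_comm] <;> ring

theorem abs_le_div_five {η s R d : ℝ} (hη : 0 ≤ η) (hs : 0 ≤ s) (hb : 55 * η ≤ b)
    (hR : b + s ≤ R) (hd : d ^ 2 ≤ 22 / 5 * η * s + 11 * η ^ 2) : |d| ≤ R / 5 := by
  refine abs_le_of_sq_le_sq ?_ (by linarith)
  nlinarith [mul_nonneg hη hs, mul_nonneg hη hη, mul_le_mul hR hR (by linarith) (by linarith),
    mul_le_mul hb hb (by linarith) (by linarith), mul_le_mul_of_nonneg_right hb hs, sq_nonneg s]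

theorem div_sub_div_ge {R D d : ℝ} (hR : 0 < R) (hd : |d| ≤ R / 5) :
    (D - d) / R - 5 / 4 * d ^ 2 / R ^ 2 ≤ D / R - d / (R - d) := by
  have h := (le_abs_self d).trans hd
  have hpos : 0 < R - d := by linarith
  have key : d / (R - d) = d / R + d ^ 2 / (R * (R - d)) := by
    field_simp
    ring
  have h2 : d ^ 2 / (R * (R - d)) ≤ 5 / 4 * d ^ 2 / R ^ 2 := by
    rw [div_le_div_iff₀ (by positivity) (by positivity)]
    nlinarith [mul_nonneg (mul_nonneg (sq_nonneg d) hR.le) (by linarith : 0 ≤ R - d - 4 / 5 * R)]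
  rw [key, sub_div]
  linarith

/-- The logarithmic gradient of `distWeight` along the `i`-th coordinate direction. -/
def logGrad (N : ℕ) (b : ℝ) (x : Tor N) (i : Fin 3) (y : Tor N) : ℝ :=
  (distWeight N b x (y + Pi.single i 1) - distWeight N b x y) / distWeight N b x y

theorem logGrad_sub_shift_ge (hη : 0 ≤ chordSq (2 ^ N) 1) (hb0 : 0 < b)
    (hb : 55 * chordSq (2 ^ N) 1 ≤ b) (x y : Tor N) (i : Fin 3) :
    chordSq (2 ^ N) 1 * (2 - chordSq (2 ^ N) (y i - x i)) / distWeight N b x y -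
      5 / 4 * (22 / 5 * chordSq (2 ^ N) 1 * chordSq (2 ^ N) (y i - x i)
        + 11 * chordSq (2 ^ N) 1 ^ 2) / distWeight N b x y ^ 2 ≤
      logGrad N b x i y - logGrad N b x i (y - Pi.single i 1) := by
  have hR := distWeight_pos hb0 x y
  have hd := sq_chordSq_sub_chordSq_sub_one_le (y i - x i)
  have habs := abs_le_div_five hη (chordSq_nonneg _) hb (add_chordSq_le_distWeight x y i) hd
  have hsub := distWeight_add_single (b := b) x y i (-1)
  rw [Pi.single_neg, ← sub_eq_add_neg, ← sub_eq_add_neg] at hsub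
  have hback : distWeight N b x (y - Pi.single i 1) = distWeight N b x y -
      (chordSq (2 ^ N) (y i - x i) - chordSq (2 ^ N) (y i - x i - 1)) := by linarith
  have h := div_sub_div_ge (D := chordSq (2 ^ N) (y i - x i + 1) - chordSq (2 ^ N) (y i - x i))
    hR habs
  rw [chordSq_add_one_add_chordSq_sub_one] at h
  simp only [logGrad, sub_add_cancel, distWeight_add_single]
  rw [show distWeight N b x y - distWeight N b x (y - Pi.single i 1) =
    chordSq (2 ^ N) (y i - x i) - chordSq (2 ^ N) (y i - x i - 1) by linarith, hback]
  refine le_trans ?_ h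
  gcongr

theorem sum_logGrad_sub_shift_ge (hη : 0 ≤ chordSq (2 ^ N) 1) (hb0 : 0 < b)
    (hb : 55 * chordSq (2 ^ N) 1 ≤ b) (x y : Tor N) :
    chordSq (2 ^ N) 1 * (1 / 2 / distWeight N b x y - 1) ≤
      ∑ i, (logGrad N b x i y - logGrad N b x i (y - Pi.single i 1)) := by
  refine le_trans ?_ (Finset.sum_le_sum fun i _ => logGrad_sub_shift_ge hη hb0 hb x y i)
  have hR := distWeight_pos hb0 x y
  have hRdef : distWeight N b x y = b + ∑ i, chordSq (2 ^ N) (y i - x i) := rfl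
  have hs := fun i => chordSq_nonneg (y i - x i)
  rw [Fin.sum_univ_three] at hRdef ⊢
  generalize distWeight N b x y = R at *
  generalize chordSq (2 ^ N) 1 = η at *
  have h0 := hs 0
  have h1 := hs 1
  have h2 := hs 2
  generalize chordSq (2 ^ N) (y 0 - x 0) = s0 at *
  generalize chordSq (2 ^ N) (y 1 - x 1) = s1 at *
  generalize chordSq (2 ^ N) (y 2 - x 2) = s2 at *
  have e1 : η * (2 - s0) / R - 5 / 4 * (22 / 5 * η * s0 + 11 * η ^ 2) / R ^ 2 +
      (η * (2 - s1) / R - 5 / 4 * (22 / 5 * η * s1 + 11 * η ^ 2) / R ^ 2) +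
      (η * (2 - s2) / R - 5 / 4 * (22 / 5 * η * s2 + 11 * η ^ 2) / R ^ 2) -
      η * (1 / 2 / R - 1) = (η * b * R + η * (11 / 2 * b - 165 / 4 * η)) / R ^ 2 := by
    obtain rfl : b = R - (s0 + s1 + s2) := by linarith
    field_simp
    ring
  have : 0 ≤ (η * b * R + η * (11 / 2 * b - 165 / 4 * η)) / R ^ 2 :=
    div_nonneg (add_nonneg (by positivity) (mul_nonneg hη (by linarith))) (by positivity)
  linarith

theorem logGrad_sq_le (hη : 0 ≤ chordSq (2 ^ N) 1) (hb0 : 0 < b)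
    (hb : 55 * chordSq (2 ^ N) 1 ≤ b) (x y : Tor N) (i : Fin 3) :
    logGrad N b x i y ^ 2 ≤ 6 * chordSq (2 ^ N) 1 / distWeight N b x y ∧
    logGrad N b x i y ^ 2 ≤ 6 * chordSq (2 ^ N) 1 / distWeight N b x (y + Pi.single i 1) := by
  have hR := distWeight_pos hb0 x y
  have hR' := distWeight_pos hb0 x (y + Pi.single i 1)
  have hle := add_chordSq_le_distWeight (b := b) x y i
  have hs := chordSq_nonneg (y i - x i)
  have hd := sq_chordSq_add_one_sub_le (y i - x i)
  rw [← distWeight_add_single (b := b) x y i 1] at hd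
  have habs := abs_le_div_five hη hs hb hle hd
  have h5 : logGrad N b x i y ^ 2 ≤ 5 * chordSq (2 ^ N) 1 / distWeight N b x y := by
    rw [logGrad, div_pow, div_le_div_iff₀ (by positivity) hR]
    nlinarith [mul_le_mul_of_nonneg_left hle hη, mul_le_mul_of_nonneg_left hb hη,
      mul_nonneg hη hs, hR.le]
  constructor
  · refine h5.trans ?_
    gcongr
    norm_num
  · refine h5.trans ?_
    rw [div_le_div_iff₀ hR hR']
    nlinarith [(le_abs_self _).trans habs]

end Weight

/-- Discrete Hardy inequality with a regularised inverse-square weight. -/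
theorem hardy_distWeight {N : ℕ} {b : ℝ} (hη : 0 ≤ chordSq (2 ^ N) 1) (hb0 : 0 < b)
    (hb : 55 * chordSq (2 ^ N) 1 ≤ b) (x : Tor N) (g : Tor N → ℝ) :
    chordSq (2 ^ N) 1 * ∑ y, g y ^ 2 / distWeight N b x y ≤
      4 * (72 * dirichletForm N g g + chordSq (2 ^ N) 1 * ∑ y, g y ^ 2) := by
  set η := chordSq (2 ^ N) 1 with hη_def
  set H := ∑ y, g y ^ 2 / distWeight N b x y with hH
  have lower : η * (1 / 2 * H - ∑ y, g y ^ 2) ≤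
      ∑ y, (∑ i, (logGrad N b x i y - logGrad N b x i (y - Pi.single i 1))) * g y ^ 2 := by
    rw [hH, Finset.mul_sum, ← Finset.sum_sub_distrib, Finset.mul_sum]
    refine Finset.sum_le_sum fun y _ => ?_
    refine le_trans (le_of_eq ?_) (mul_le_mul_of_nonneg_right
      (sum_logGrad_sub_shift_ge hη hb0 hb x y) (sq_nonneg (g y)))
    rw [← hη_def]
    ring
  have parts : ∑ y, (∑ i, (logGrad N b x i y - logGrad N b x i (y - Pi.single i 1))) * g y ^ 2 =
      ∑ i, ∑ y, logGrad N b x i y * (g y ^ 2 - g (y + Pi.single i 1) ^ 2) := by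
    simp only [Finset.sum_mul]
    rw [Finset.sum_comm]
    exact Finset.sum_congr rfl fun i _ =>
      sum_sub_shift_mul (logGrad N b x i) (fun y => g y ^ 2) (Pi.single i (1 : ZMod (2 ^ N)))
  have upper : ∀ i, ∑ y, logGrad N b x i y * (g y ^ 2 - g (y + Pi.single i 1) ^ 2) ≤
      72 * ∑ y, (g (y + Pi.single i 1) - g y) * (g (y + Pi.single i 1) - g y) + 1 / 12 * (η * H) := by
    intro i
    have hshift : ∑ y, g (y + Pi.single i 1) ^ 2 / distWeight N b x (y + Pi.single i 1) = H :=
      (sum_add_right_eq (fun y => g y ^ 2 / distWeight N b x y)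
        (Pi.single i (1 : ZMod (2 ^ N)))).trans hH.symm
    have hsum : 72 * ∑ y, (g (y + Pi.single i 1) - g y) * (g (y + Pi.single i 1) - g y) +
        1 / 12 * (η * H) =
        ∑ y, (72 * ((g (y + Pi.single i 1) - g y) * (g (y + Pi.single i 1) - g y)) +
          1 / 24 * (η * (g y ^ 2 / distWeight N b x y)) +
          1 / 24 * (η * (g (y + Pi.single i 1) ^ 2 / distWeight N b x (y + Pi.single i 1)))) := by
      simp only [Finset.sum_add_distrib, ← Finset.mul_sum, hshift, ← hH]
      ring
    rw [hsum]
    refine Finset.sum_le_sum fun y _ => ?_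
    obtain ⟨h1, h2⟩ := logGrad_sq_le hη hb0 hb x y i
    have k1 := mul_le_mul_of_nonneg_right h1 (sq_nonneg (g y))
    have k2 := mul_le_mul_of_nonneg_right h2 (sq_nonneg (g (y + Pi.single i 1)))
    rw [div_mul_eq_mul_div, mul_assoc, mul_div_assoc, mul_div_assoc] at k1 k2
    generalize g (y + Pi.single i 1) = q at *
    generalize logGrad N b x i y = v at *
    have young : v * (g y ^ 2 - q ^ 2) ≤
        72 * ((q - g y) * (q - g y)) + 1 / 144 * (v ^ 2 * g y ^ 2 + v ^ 2 * q ^ 2) := by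
      nlinarith [sq_nonneg (144 * (q - g y) + v * (q + g y)), sq_nonneg (v * (q - g y))]
    linarith
  have total := Finset.sum_le_sum fun i (_ : i ∈ Finset.univ) => upper i
  rw [← parts, Finset.sum_add_distrib, ← Finset.mul_sum] at total
  rw [Finset.sum_const, Finset.card_univ, Fintype.card_fin, nsmul_eq_mul] at total
  have hform : ∑ i : Fin 3, ∑ y : Tor N,
      (g (y + Pi.single i 1) - g y) * (g (y + Pi.single i 1) - g y) = dirichletForm N g g := rfl
  rw [hform] at total
  push_cast at total
  linarith

theorem sum_sq_ball_le {N : ℕ} {ν : ℝ} (hν : ((2:ℝ)^N)⁻¹ ≤ ν) (hν1 : ν ≤ 1) (x : Tor N)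
    (g : Tor N → ℝ) (B : Finset (Tor N)) (hB : ∀ y ∈ B, ∀ i, |torRep N (y i - x i)| ≤ ν / 4) :
    ∑ y ∈ B, g y ^ 2 ≤ 5000 * Real.pi ^ 2 * ν ^ 2 *
      (((2:ℝ)^N)^2 * dirichletForm N g g + ∑ y, g y ^ 2) := by
  have hν0 : 0 < ν := lt_of_lt_of_le (by positivity) hν
  have hpi := Real.pi_gt_three
  have hE := dirichletForm_self_nonneg N g
  have hP : 0 ≤ ∑ y, g y ^ 2 := Finset.sum_nonneg fun _ _ => sq_nonneg _
  rcases Nat.eq_zero_or_pos N with rfl | hN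
  · have : ν = 1 := le_antisymm hν1 (by simpa using hν)
    subst this
    have h1 : ∑ y ∈ B, g y ^ 2 ≤ ∑ y, g y ^ 2 :=
      Finset.sum_le_sum_of_subset_of_nonneg (Finset.subset_univ _) fun _ _ _ => sq_nonneg _
    refine h1.trans ?_
    nlinarith [mul_nonneg hE (sq_nonneg Real.pi), mul_nonneg hP (by nlinarith : 0 ≤ Real.pi ^ 2 - 1)]
  have hη : 0 ≤ chordSq (2 ^ N) 1 := chordSq_nonneg _
  have hn : 2 ≤ 2 ^ N := Nat.le_self_pow hN.ne' 2
  have hlow := le_chordSq_one hn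
  have hup := chordSq_one_le (n := 2 ^ N)
  push_cast at hlow hup
  have hη4 : chordSq (2 ^ N) 1 ≤ 4 * Real.pi ^ 2 * ν ^ 2 := by
    refine hup.trans ?_
    rw [div_eq_mul_inv, mul_pow, mul_pow]
    norm_num only
    gcongr
  set b := 220 * Real.pi ^ 2 * ν ^ 2 with hb_def
  have hb0 : 0 < b := by positivity
  have hardy := hardy_distWeight hη hb0 (by linarith) x g
  set H := ∑ y, g y ^ 2 / distWeight N b x y with hH
  have hterm : ∀ y, 0 ≤ g y ^ 2 / distWeight N b x y := fun y =>
    div_nonneg (sq_nonneg _) (distWeight_pos hb0 x y).le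
  have hBH : ∑ y ∈ B, g y ^ 2 ≤ 221 * Real.pi ^ 2 * ν ^ 2 * H := by
    calc ∑ y ∈ B, g y ^ 2
        ≤ ∑ y ∈ B, 221 * Real.pi ^ 2 * ν ^ 2 * (g y ^ 2 / distWeight N b x y) := by
          refine Finset.sum_le_sum fun y hy => ?_
          have hR := distWeight_pos hb0 x y
          have hRle : distWeight N b x y ≤ 221 * Real.pi ^ 2 * ν ^ 2 := by
            have hs : ∀ i ∈ Finset.univ, chordSq (2 ^ N) (y i - x i) ≤ Real.pi ^ 2 * ν ^ 2 / 4 := by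
              intro i _
              refine (chordSq_le_torRep_sq N _).trans ?_
              have := sq_le_sq' (abs_le.mp (hB y hy i)).1 (abs_le.mp (hB y hy i)).2
              nlinarith [mul_le_mul_of_nonneg_left this (sq_nonneg Real.pi)]
            have := Finset.sum_le_sum hs
            rw [Finset.sum_const, Finset.card_univ, Fintype.card_fin, nsmul_eq_mul] at this
            push_cast at this
            unfold distWeight
            nlinarith [sq_nonneg (Real.pi * ν)]
          rw [← mul_div_assoc, le_div_iff₀ hR, mul_comm]
          exact mul_le_mul_of_nonneg_right hRle (sq_nonneg _)
      _ ≤ 221 * Real.pi ^ 2 * ν ^ 2 * H := by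
          rw [← Finset.mul_sum]
          exact mul_le_mul_of_nonneg_left (Finset.sum_le_sum_of_subset_of_nonneg
            (Finset.subset_univ _) fun y _ _ => hterm y) (by positivity)
  have hηpos : 0 < chordSq (2 ^ N) 1 := lt_of_lt_of_le (by positivity) hlow
  have hE' : 16 * dirichletForm N g g ≤
      chordSq (2 ^ N) 1 * (((2:ℝ)^N)^2 * dirichletForm N g g) := by
    rw [div_le_iff₀ (by positivity)] at hlow
    nlinarith
  have hHle : H ≤ 18 * (((2:ℝ)^N)^2 * dirichletForm N g g + ∑ y, g y ^ 2) := by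
    refine le_of_mul_le_mul_left ?_ hηpos
    nlinarith [mul_nonneg hη hP]
  calc ∑ y ∈ B, g y ^ 2 ≤ 221 * Real.pi ^ 2 * ν ^ 2 * H := hBH
    _ ≤ 221 * Real.pi ^ 2 * ν ^ 2 * (18 * (((2:ℝ)^N)^2 * dirichletForm N g g + ∑ y, g y ^ 2)) := by
        gcongr
    _ ≤ _ := by
        have : 0 ≤ Real.pi ^ 2 * ν ^ 2 * (((2:ℝ)^N)^2 * dirichletForm N g g + ∑ y, g y ^ 2) := by
          positivity
        linarith

theorem card_filter_torRep_le (N : ℕ) {ν : ℝ} (hν : ((2:ℝ)^N)⁻¹ ≤ ν) :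
    ((Finset.univ.filter fun m : ZMod (2 ^ N) => |torRep N m| ≤ ν / 4).card : ℝ) ≤
      2 * (ν * 2 ^ N) := by
  have hν0 : 0 < ν := lt_of_lt_of_le (by positivity) hν
  have hn : (0:ℝ) < 2 ^ N := by positivity
  have hone : 1 ≤ ν * 2 ^ N := by
    rwa [inv_le_iff_one_le_mul₀ hn] at hν
  set k := ⌊ν / 4 * 2 ^ N⌋₊ with hk
  have hkle : (k : ℝ) ≤ ν / 4 * 2 ^ N := Nat.floor_le (by positivity)
  have hsub : ((Finset.univ.filter fun m : ZMod (2 ^ N) => |torRep N m| ≤ ν / 4).image ZMod.val) ⊆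
      Finset.range (k + 1) ∪ Finset.Ico (2 ^ N - k) (2 ^ N) := by
    intro j hj
    obtain ⟨m, hm, rfl⟩ := Finset.mem_image.mp hj
    have hm := (Finset.mem_filter.mp hm).2
    have hlt : m.val < 2 ^ N := ZMod.val_lt m
    rw [torRep, abs_le] at hm
    rw [Finset.mem_union, Finset.mem_range, Finset.mem_Ico]
    split_ifs at hm with h
    · left
      rw [Nat.lt_succ_iff]
      refine Nat.le_floor ?_
      have := hm.2
      rwa [← div_eq_mul_inv, div_le_iff₀ hn] at this
    · right
      refine ⟨?_, hlt⟩
      have h1 := hm.1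
      have h2 : ((2 ^ N - m.val : ℕ) : ℝ) ≤ ν / 4 * 2 ^ N := by
        rw [Nat.cast_sub hlt.le]
        push_cast
        have : (m.val : ℝ) * ((2:ℝ)^N)⁻¹ * 2 ^ N = m.val := inv_mul_cancel_right₀ hn.ne' _
        nlinarith
      have := Nat.le_floor h2
      omega
  have hcard := Finset.card_le_card hsub
  rw [Finset.card_image_of_injective _ (ZMod.val_injective _)] at hcard
  have h2 := hcard.trans (Finset.card_union_le _ _)
  rw [Finset.card_range, Nat.card_Ico] at h2
  have h3 : (Finset.univ.filter fun m : ZMod (2 ^ N) => |torRep N m| ≤ ν / 4).card ≤ 2 * k + 1 := by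
    omega
  have h4 : ((Finset.univ.filter fun m : ZMod (2 ^ N) => |torRep N m| ≤ ν / 4).card : ℝ) ≤
      2 * k + 1 := by exact_mod_cast h3
  linarith

theorem card_torus_ball_le (N : ℕ) {ν : ℝ} (hν : ((2:ℝ)^N)⁻¹ ≤ ν) (x : Tor N) :
    ((Finset.univ.filter fun y : Tor N => ∀ i, |torRep N (y i - x i)| ≤ ν / 4).card : ℝ) ≤
      (2 * (ν * 2 ^ N)) ^ 3 := by
  have h : (Finset.univ.filter fun y : Tor N => ∀ i, |torRep N (y i - x i)| ≤ ν / 4).card ≤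
      (Finset.univ.filter fun m : ZMod (2 ^ N) => |torRep N m| ≤ ν / 4).card ^ 3 := by
    rw [← Fintype.card_piFinset_const]
    refine Finset.card_le_card_of_injOn (fun y => y - x) (fun y hy => ?_)
      (sub_left_injective.injOn)
    simpa using hy
  calc _ ≤ ((Finset.univ.filter fun m : ZMod (2 ^ N) => |torRep N m| ≤ ν / 4).card : ℝ) ^ 3 := by
        exact_mod_cast h
    _ ≤ _ := pow_le_pow_left₀ (Nat.cast_nonneg _) (card_filter_torRep_le N hν) 3

/-- Uniform bound on the resolvent quadratic form at the scale `ν`. -/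
theorem torInner_torTest_le {a M : ℝ} (ha : 0 < a) {φ : (Fin 3 → ℝ) → ℝ}
    (hM : ∀ y, |φ y| ≤ M) (hφsupp : ∀ y : Fin 3 → ℝ, ¬(‖y‖ ≤ 1/4) → φ y = 0)
    {N : ℕ} {ν : ℝ} (hν : ((2:ℝ)^N)⁻¹ ≤ ν) (hν1 : ν ≤ 1) (x : Tor N) (g : Tor N → ℝ)
    (hg : (fun y => a * g y - discLap N g y) = torTest N φ ν x) :
    torInner N (torTest N φ ν x) g ≤ 40000 * Real.pi ^ 2 * M ^ 2 * (1 + 1 / a) * ν⁻¹ := by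
  have hν0 : 0 < ν := lt_of_lt_of_le (by positivity) hν
  have hn : (0:ℝ) < 2 ^ N := by positivity
  set B := Finset.univ.filter fun y : Tor N => ∀ i, |torRep N (y i - x i)| ≤ ν / 4 with hB
  have hout : ∀ y, y ∉ B → torTest N φ ν x y = 0 := by
    intro y hy
    rw [torTest, hφsupp, mul_zero]
    intro hle
    refine hy (Finset.mem_filter.mpr ⟨Finset.mem_univ _, fun i => ?_⟩)
    have := (norm_le_pi_norm (fun i => torRep N (y i - x i) / ν) i).trans hle
    rw [Real.norm_eq_abs, abs_div, abs_of_pos hν0, div_le_iff₀ hν0] at this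
    linarith
  have hsumB : ∑ y, torTest N φ ν x y * g y = ∑ y ∈ B, torTest N φ ν x y * g y :=
    (Finset.sum_subset (Finset.subset_univ _) fun y _ hy => by rw [hout y hy, zero_mul]).symm
  have hsq : ∑ y ∈ B, torTest N φ ν x y ^ 2 ≤ (2 * (ν * 2 ^ N)) ^ 3 * ((ν ^ 3)⁻¹ * M) ^ 2 := by
    have hterm : ∀ y ∈ B, torTest N φ ν x y ^ 2 ≤ ((ν ^ 3)⁻¹ * M) ^ 2 := by
      intro y _
      rw [torTest, mul_pow, mul_pow]
      refine mul_le_mul_of_nonneg_left ?_ (sq_nonneg _)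
      exact sq_le_sq' (abs_le.mp (hM _)).1 (abs_le.mp (hM _)).2
    refine (Finset.sum_le_card_nsmul _ _ _ hterm).trans ?_
    rw [nsmul_eq_mul]
    exact mul_le_mul_of_nonneg_right (card_torus_ball_le N hν x) (sq_nonneg _)
  have hball := sum_sq_ball_le hν hν1 x g B fun y hy => (Finset.mem_filter.mp hy).2
  have hE := dirichletForm_self_nonneg N g
  have hP : 0 ≤ ∑ y, g y ^ 2 := Finset.sum_nonneg fun _ _ => sq_nonneg _
  set Q := torInner N (torTest N φ ν x) g with hQ
  have hQE : Q = (((2:ℝ)^N)⁻¹)^3 * (a * ∑ y, g y ^ 2 + ((2:ℝ)^N)^2 * dirichletForm N g g) := by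
    rw [hQ, ← hg, torInner_resolvent]
    simp only [sq]
  have hQ0 : 0 ≤ Q := by
    rw [hQE]
    positivity
  have hQB : Q = (((2:ℝ)^N)⁻¹)^3 * ∑ y ∈ B, torTest N φ ν x y * g y := by
    rw [hQ, torInner, hsumB]
  have hcs := Finset.sum_mul_sq_le_sq_mul_sq B (torTest N φ ν x) g
  have henergy : (((2:ℝ)^N)⁻¹)^3 * (((2:ℝ)^N)^2 * dirichletForm N g g + ∑ y, g y ^ 2) ≤
      (1 + 1 / a) * Q := by
    rw [hQE, mul_left_comm]
    refine mul_le_mul_of_nonneg_left ?_ (by positivity)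
    have e : (1 + 1 / a) * (a * ∑ y, g y ^ 2 + ((2:ℝ)^N)^2 * dirichletForm N g g) =
        ((2:ℝ)^N)^2 * dirichletForm N g g + ∑ y, g y ^ 2 +
        (a * ∑ y, g y ^ 2 + 1 / a * (((2:ℝ)^N)^2 * dirichletForm N g g)) := by
      field_simp
      ring
    rw [e]
    exact le_add_of_nonneg_right (by positivity)
  have hQsq : Q ^ 2 ≤ 40000 * Real.pi ^ 2 * M ^ 2 * (1 + 1 / a) * ν⁻¹ * Q := by
    calc Q ^ 2 = ((((2:ℝ)^N)⁻¹)^3) ^ 2 * (∑ y ∈ B, torTest N φ ν x y * g y) ^ 2 := by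
          rw [hQB, mul_pow]
      _ ≤ ((((2:ℝ)^N)⁻¹)^3) ^ 2 * (((2 * (ν * 2 ^ N)) ^ 3 * ((ν ^ 3)⁻¹ * M) ^ 2) *
          (5000 * Real.pi ^ 2 * ν ^ 2 *
            (((2:ℝ)^N)^2 * dirichletForm N g g + ∑ y, g y ^ 2))) := by
          refine mul_le_mul_of_nonneg_left (hcs.trans ?_) (by positivity)
          exact mul_le_mul hsq hball (Finset.sum_nonneg fun _ _ => sq_nonneg _) (by positivity)
      _ = 40000 * Real.pi ^ 2 * M ^ 2 * ν⁻¹ * ((((2:ℝ)^N)⁻¹)^3 *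
            (((2:ℝ)^N)^2 * dirichletForm N g g + ∑ y, g y ^ 2)) := by
          generalize (2:ℝ) ^ N = n at *
          field_simp
          ring
      _ ≤ 40000 * Real.pi ^ 2 * M ^ 2 * ν⁻¹ * ((1 + 1 / a) * Q) :=
          mul_le_mul_of_nonneg_left henergy (by positivity)
      _ = _ := by ring
  rcases hQ0.eq_or_lt with h0 | hpos
  · rw [← h0]
    positivity
  · refine le_of_mul_le_mul_right ?_ hpos
    rwa [← sq]

/-- **Uniform resolvent bound on the discrete torus.**  For `a > 0`, `κ > 0` and a smooth `φ`
supported in `{|y|_∞ ≤ 1/4}`, the operator `a − Δ^ε` is symmetric and positive definite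
(in particular invertible), and `⟨φ_x^ν, (a − Δ^ε)^{−1} φ_x^ν⟩_ε ≤ C ν^{−1−κ}` uniformly in
`N`, `ν ∈ [ε,1]` and `x ∈ 𝕋³_ε`. -/
theorem discrete_resolvent_bound (a κ : ℝ) (ha : 0 < a) (hκ : 0 < κ)
    (φ : (Fin 3 → ℝ) → ℝ) (hφ : ContDiff ℝ (⊤ : ℕ∞) φ)
    (hφsupp : ∀ y : Fin 3 → ℝ, ¬(‖y‖ ≤ 1/4) → φ y = 0) :
    (∀ N : ℕ, ∀ f g : Tor N → ℝ,
      torInner N (fun x => a * f x - discLap N f x) g =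
        torInner N f (fun x => a * g x - discLap N g x)) ∧
    (∀ N : ℕ, ∀ f : Tor N → ℝ, f ≠ 0 →
      0 < torInner N (fun x => a * f x - discLap N f x) f) ∧
    (∀ N : ℕ,
      Function.Bijective (fun f : Tor N → ℝ => fun x => a * f x - discLap N f x)) ∧
    (∃ C : ℝ, 0 < C ∧
      ∀ N : ℕ, ∀ ν : ℝ, ((2:ℝ)^N)⁻¹ ≤ ν → ν ≤ 1 → ∀ x : Tor N, ∀ g : Tor N → ℝ,
        (fun y => a * g y - discLap N g y) = torTest N φ ν x →
        torInner N (torTest N φ ν x) g ≤ C * ν ^ (-1 - κ)) := by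
  refine ⟨fun N f g => torInner_resolvent_symm N a f g,
    fun N f hf => torInner_resolvent_pos N ha hf, fun N => resolvent_bijective N ha, ?_⟩
  obtain ⟨M, hM⟩ : ∃ M, ∀ y, |φ y| ≤ M := by
    obtain ⟨M, hM⟩ := (isCompact_closedBall (0 : Fin 3 → ℝ) (1 / 4)).exists_bound_of_continuousOn
      hφ.continuous.continuousOn
    refine ⟨max M 0, fun y => ?_⟩
    by_cases hy : ‖y‖ ≤ 1 / 4
    · exact (hM y (mem_closedBall_zero_iff.mpr hy)).trans (le_max_left _ _)
    · rw [hφsupp y hy, abs_zero]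
      exact le_max_right _ _
  refine ⟨40000 * Real.pi ^ 2 * M ^ 2 * (1 + 1 / a) + 1, by positivity, ?_⟩
  intro N ν hν hν1 x g hg
  have hν0 : 0 < ν := lt_of_lt_of_le (by positivity) hν
  refine (torInner_torTest_le ha hM hφsupp hν hν1 x g hg).trans ?_
  refine mul_le_mul (by linarith) ?_ (by positivity) (by positivity)
  rw [← Real.rpow_neg_one]
  exact Real.rpow_le_rpow_of_exponent_ge hν0 hν1 (by linarith)
end
end

section
/- Let d ≥ 1, ζ ≥ 0 and α ∈ ℝ satisfy 2α − ζ > −d. Then there exists a constant C such that for every N ∈ ℕ, ε = 2^{-N}, and every λ ∈ [ε,1], one has ε^{2d} Σ ((|x₁|_∞ ∨ ε) + (|x₂|_∞ ∨ ε))^ζ (|x₁−x₂|_∞ ∨ ε)^{2α−ζ} ≤ C λ^{2α+2d}, where the sum runs over all pairs x₁, x₂ ∈ (εℤ)^d with |x₁|_∞ ≤ λ and |x₂|_∞ ≤ λ. -/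
noncomputable section

open scoped BigOperators

/-- The dyadic mesh size `ε = 2^{-N}`. -/
def meps (N : ℕ) : ℝ := (2:ℝ) ^ (-(N:ℤ))

/-- The grid point of `(εℤ)^d` with integer coordinates `y`. -/
def gridPt (d N : ℕ) (y : Fin d → ℤ) : Fin d → ℝ := fun i => meps N * (y i : ℝ)

/-- The lattice box `{-K, …, K}^d`. -/
def latticeBox (d K : ℕ) : Finset (Fin d → ℤ) :=
  Fintype.piFinset fun _ => Finset.Icc (-(K:ℤ)) K

theorem mem_latticeBox {d K : ℕ} {y : Fin d → ℤ} : y ∈ latticeBox d K ↔ ‖y‖ ≤ K := by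
  rw [latticeBox, Fintype.mem_piFinset, pi_norm_le_iff_of_nonneg (Nat.cast_nonneg K)]
  refine forall_congr' fun i => ?_
  rw [Finset.mem_Icc, ← abs_le, Int.norm_eq_abs]
  exact_mod_cast Iff.rfl

theorem card_latticeBox (d K : ℕ) : (latticeBox d K).card = (2 * K + 1) ^ d := by
  simp only [latticeBox, Fintype.card_piFinset, Int.card_Icc, Finset.prod_const,
    Finset.card_univ, Fintype.card_fin]
  congr 1
  omega

theorem card_latticeBox_le {d K : ℕ} (hK : 1 ≤ K) :
    ((latticeBox d K).card : ℝ) ≤ 3 ^ d * (K:ℝ) ^ d := by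
  rw [card_latticeBox, ← mul_pow]
  have : (1:ℝ) ≤ K := by exact_mod_cast hK
  push_cast
  gcongr
  linarith

/-- Comparison of a power sum with the integral of `t ^ (p - 1)`. -/
theorem sum_succ_rpow_sub_one_le {p : ℝ} (hp : 0 < p) (hp1 : p ≤ 1) (K : ℕ) :
    ∑ n ∈ Finset.range K, ((n:ℝ) + 1) ^ (p - 1) ≤ (K:ℝ) ^ p / p := by
  induction K with
  | zero => simp [Real.zero_rpow hp.ne']
  | succ K ih =>
    rw [Finset.sum_range_succ]
    have hpos : (0:ℝ) < K + 1 := by positivity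
    have hb := rpow_one_add_le_one_add_mul_self (s := -1 / ((K:ℝ) + 1))
      (by rw [le_div_iff₀ hpos]; nlinarith [(Nat.cast_nonneg K : (0:ℝ) ≤ K)]) hp.le hp1
    have he : 1 + -1 / ((K:ℝ) + 1) = K / (K + 1) := by field_simp; ring
    rw [he, Real.div_rpow (Nat.cast_nonneg K) hpos.le, div_le_iff₀ (by positivity)] at hb
    have hs : ((K:ℝ) + 1) ^ (p - 1) = ((K:ℝ) + 1) ^ p / (K + 1) := Real.rpow_sub_one hpos.ne' p
    have : (K:ℝ) ^ p + p * ((K:ℝ) + 1) ^ (p - 1) ≤ ((K:ℝ) + 1) ^ p := by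
      rw [hs]
      calc _ ≤ _ := add_le_add_left hb _
        _ = _ := by field_simp; ring
    push_cast
    rw [le_div_iff₀ hp] at ih ⊢
    linarith

theorem sum_Icc_max_abs_rpow_le {p : ℝ} (hp : 0 < p) (hp1 : p ≤ 1) {K : ℕ} (hK : 1 ≤ K) :
    ∑ j ∈ Finset.Icc (-(K:ℤ)) K, max ‖j‖ 1 ^ (p - 1) ≤ (1 + 2 / p) * (K:ℝ) ^ p := by
  have key : ∀ L : ℕ, ∑ j ∈ Finset.Icc (-(L:ℤ)) L, max ‖j‖ 1 ^ (p - 1) =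
      1 + 2 * ∑ n ∈ Finset.range L, ((n:ℝ) + 1) ^ (p - 1) := by
    intro L
    induction L with
    | zero => simp
    | succ L ih =>
      have hI : Finset.Icc (-((L + 1 : ℕ):ℤ)) ((L + 1 : ℕ):ℤ) =
          insert (-((L:ℤ) + 1)) (insert ((L:ℤ) + 1) (Finset.Icc (-(L:ℤ)) L)) := by
        ext j
        simp only [Finset.mem_insert, Finset.mem_Icc]
        omega
      have hn : ‖(L:ℤ) + 1‖ = (L:ℝ) + 1 := by
        rw [Int.norm_eq_abs]
        push_cast
        exact abs_of_nonneg (by positivity)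
      rw [hI, Finset.sum_insert, Finset.sum_insert, ih, Finset.sum_range_succ, norm_neg, hn,
        max_eq_left (by linarith [(Nat.cast_nonneg L : (0:ℝ) ≤ L)])]
      · ring
      · simp
      · simp only [Finset.mem_insert, Finset.mem_Icc]
        omega
  rw [key]
  have h1 : (1:ℝ) ≤ (K:ℝ) ^ p := Real.one_le_rpow (by exact_mod_cast hK) hp.le
  have := sum_succ_rpow_sub_one_le hp hp1 K
  calc _ ≤ (K:ℝ) ^ p + 2 * ((K:ℝ) ^ p / p) := by gcongr
    _ = _ := by ring

/-- The singularity `|k|^β` is summable near the origin for `β > -d`, quantitatively on boxes. -/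
theorem exists_sum_latticeBox_le (d : ℕ) (hd : 1 ≤ d) {β : ℝ} (hβ : -(d:ℝ) < β) :
    ∃ C : ℝ, 0 < C ∧ ∀ K : ℕ, 1 ≤ K →
      ∑ k ∈ latticeBox d K, max ‖k‖ 1 ^ β ≤ C * (K:ℝ) ^ (β + d) := by
  have hd0 : (0:ℝ) < d := by exact_mod_cast hd
  rcases le_total 0 β with h | h
  · refine ⟨3 ^ d, by positivity, fun K hK => ?_⟩
    have hK1 : (1:ℝ) ≤ K := by exact_mod_cast hK
    have hK0 : (0:ℝ) < K := by linarith
    calc ∑ k ∈ latticeBox d K, max ‖k‖ 1 ^ β ≤ ∑ _k ∈ latticeBox d K, (K:ℝ) ^ β := by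
          gcongr with k hk
          exact max_le (mem_latticeBox.1 hk) hK1
      _ = (latticeBox d K).card * (K:ℝ) ^ β := by rw [Finset.sum_const, nsmul_eq_mul]
      _ ≤ 3 ^ d * (K:ℝ) ^ d * (K:ℝ) ^ β := by gcongr; exact card_latticeBox_le hK
      _ = 3 ^ d * (K:ℝ) ^ (β + d) := by
          rw [Real.rpow_add hK0, Real.rpow_natCast]; ring
  · set p : ℝ := β / d + 1 with hp
    have hp0 : 0 < p := by
      have : -1 < β / d := by rw [lt_div_iff₀ hd0]; linarith
      linarith
    have hp1 : p ≤ 1 := by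
      have : β / d ≤ 0 := div_nonpos_of_nonpos_of_nonneg h hd0.le
      linarith
    have hpd : (p - 1) * d = β := by rw [hp]; field_simp; ring
    refine ⟨(1 + 2 / p) ^ d, by positivity, fun K hK => ?_⟩
    have hK0 : (0:ℝ) < K := by exact_mod_cast hK
    calc ∑ k ∈ latticeBox d K, max ‖k‖ 1 ^ β
        ≤ ∑ k ∈ latticeBox d K, ∏ i, max ‖k i‖ 1 ^ (p - 1) := by
          refine Finset.sum_le_sum fun k _ => ?_
          calc max ‖k‖ 1 ^ β = ∏ _i : Fin d, max ‖k‖ 1 ^ (p - 1) := by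
                rw [Finset.prod_const, Finset.card_univ, Fintype.card_fin, ← Real.rpow_natCast,
                  ← Real.rpow_mul (by positivity), hpd]
            _ ≤ _ := by
                refine Finset.prod_le_prod (fun i _ => by positivity) fun i _ => ?_
                exact Real.rpow_le_rpow_of_nonpos (by positivity)
                  (max_le_max_right _ (norm_le_pi_norm k i)) (by linarith)
      _ = (∑ j ∈ Finset.Icc (-(K:ℤ)) K, max ‖j‖ 1 ^ (p - 1)) ^ d := by
          rw [latticeBox, Finset.sum_prod_piFinset (Finset.Icc (-(K:ℤ)) K)
            (fun (_ : Fin d) (j : ℤ) => max ‖j‖ 1 ^ (p - 1))]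
          simp
      _ ≤ ((1 + 2 / p) * (K:ℝ) ^ p) ^ d := by
          gcongr
          exact sum_Icc_max_abs_rpow_le hp0 hp1 hK
      _ = (1 + 2 / p) ^ d * (K:ℝ) ^ (β + d) := by
          rw [mul_pow, ← Real.rpow_natCast ((K:ℝ) ^ p), ← Real.rpow_mul hK0.le]
          congr 2
          linarith

theorem sum_latticeBox_sub_le {d M : ℕ} (f : (Fin d → ℤ) → ℝ) (hf : ∀ z, 0 ≤ f z)
    {x : Fin d → ℤ} (hx : x ∈ latticeBox d M) :
    ∑ y ∈ latticeBox d M, f (x - y) ≤ ∑ z ∈ latticeBox d (2 * M), f z := by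
  rw [← Finset.sum_image (f := f) (s := latticeBox d M) (g := fun y => x - y)
    (fun a _ b _ h => sub_right_injective h)]
  refine Finset.sum_le_sum_of_subset_of_nonneg ?_ fun z _ _ => hf z
  intro z hz
  obtain ⟨y, hy, rfl⟩ := Finset.mem_image.1 hz
  rw [mem_latticeBox] at *
  push_cast
  linarith [norm_sub_le x y]

theorem meps_pos (N : ℕ) : 0 < meps N := by unfold meps; positivity

theorem norm_gridPt (d N : ℕ) (y : Fin d → ℤ) : ‖gridPt d N y‖ = meps N * ‖y‖ := by
  have h : gridPt d N y = meps N • fun i => (y i : ℝ) := rfl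
  rw [h, norm_smul, Real.norm_of_nonneg (meps_pos N).le]
  rfl

theorem gridPt_sub (d N : ℕ) (x y : Fin d → ℤ) :
    gridPt d N x - gridPt d N y = gridPt d N (x - y) := by
  ext i
  simp [gridPt, mul_sub]

theorem max_norm_gridPt (d N : ℕ) (y : Fin d → ℤ) :
    max ‖gridPt d N y‖ (meps N) = meps N * max ‖y‖ 1 := by
  rw [norm_gridPt, mul_max_of_nonneg _ _ (meps_pos N).le, mul_one]

theorem norm_gridPt_le_iff {d N : ℕ} {lam : ℝ} (hlam : 0 ≤ lam) (y : Fin d → ℤ) :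
    ‖gridPt d N y‖ ≤ lam ↔ y ∈ latticeBox d ⌊lam / meps N⌋₊ := by
  have hq : 0 ≤ lam / meps N := div_nonneg hlam (meps_pos N).le
  rw [norm_gridPt, mul_comm, ← le_div_iff₀ (meps_pos N), latticeBox, Fintype.mem_piFinset,
    pi_norm_le_iff_of_nonneg hq]
  refine forall_congr' fun i => ?_
  rw [Finset.mem_Icc, ← abs_le, Int.abs_eq_natAbs, Nat.cast_le, Nat.le_floor_iff hq,
    Nat.cast_natAbs, Int.cast_abs, Int.norm_eq_abs]

/-- **A discrete convolution-type sum estimate.**  Let `d ≥ 1`, `ζ ≥ 0` and `α ∈ ℝ` with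
`2α − ζ > −d`.  Then there is a constant `C` such that for every `N`, `ε = 2^{-N}` and every
`λ ∈ [ε,1]`,
`ε^{2d} Σ ((|x₁|_∞ ∨ ε) + (|x₂|_∞ ∨ ε))^ζ (|x₁−x₂|_∞ ∨ ε)^{2α−ζ} ≤ C λ^{2α+2d}`,
the sum running over all pairs `x₁, x₂ ∈ (εℤ)^d` with `|x₁|_∞ ≤ λ`, `|x₂|_∞ ≤ λ`. -/
theorem discrete_sum_estimate (d : ℕ) (hd : 1 ≤ d) (ζ α : ℝ) (hζ : 0 ≤ ζ)
    (hα : -(d:ℝ) < 2*α - ζ) :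
    ∃ C : ℝ, 0 < C ∧ ∀ N : ℕ, ∀ lam : ℝ, meps N ≤ lam → lam ≤ 1 →
      meps N ^ (2*d) *
        ∑' p : (Fin d → ℤ) × (Fin d → ℤ),
          (if ‖gridPt d N p.1‖ ≤ lam ∧ ‖gridPt d N p.2‖ ≤ lam then
            (max ‖gridPt d N p.1‖ (meps N) + max ‖gridPt d N p.2‖ (meps N)) ^ ζ *
              max ‖gridPt d N p.1 - gridPt d N p.2‖ (meps N) ^ (2*α - ζ)
          else 0)
      ≤ C * lam ^ (2*α + 2*(d:ℝ)) := by
  obtain ⟨C, hC, hsum⟩ := exists_sum_latticeBox_le d hd hα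
  set β : ℝ := 2*α - ζ with hβ
  have hβd : 0 ≤ β + d := by linarith
  refine ⟨2 ^ ζ * 3 ^ d * C * 2 ^ (β + d), by positivity, fun N lam hlam _ => ?_⟩
  have hε := meps_pos N
  have hlam0 : 0 < lam := hε.trans_le hlam
  set ε := meps N with hεdef
  set M := ⌊lam / ε⌋₊ with hM
  have hM1 : 1 ≤ M := Nat.le_floor (by rw [Nat.cast_one, le_div_iff₀ hε]; linarith)
  have hMle : (M:ℝ) ≤ lam / ε := Nat.floor_le (by positivity)
  have hiff : ∀ y : Fin d → ℤ, ‖gridPt d N y‖ ≤ lam ↔ y ∈ latticeBox d M :=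
    norm_gridPt_le_iff hlam0.le
  have hle : ∀ y ∈ latticeBox d M, max ‖gridPt d N y‖ ε ≤ lam := fun y hy =>
    max_le ((hiff y).2 hy) hlam
  have hinner : ∀ x ∈ latticeBox d M,
      ∑ y ∈ latticeBox d M, max ‖x - y‖ 1 ^ β ≤ C * (2 * (lam / ε)) ^ (β + d) := fun x hx =>
    calc _ ≤ ∑ z ∈ latticeBox d (2 * M), max ‖z‖ 1 ^ β :=
          sum_latticeBox_sub_le (fun z => max ‖z‖ 1 ^ β) (fun z => by positivity) hx
      _ ≤ C * ((2 * M : ℕ):ℝ) ^ (β + d) := hsum _ (by omega)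
      _ ≤ _ := by push_cast; gcongr
  rw [tsum_eq_sum (s := latticeBox d M ×ˢ latticeBox d M)]
  · calc _ ≤ ε ^ (2*d) * ∑ p ∈ latticeBox d M ×ˢ latticeBox d M,
            (2 * lam) ^ ζ * (ε ^ β * max ‖p.1 - p.2‖ 1 ^ β) := by
          gcongr with p hp
          obtain ⟨h1, h2⟩ := Finset.mem_product.1 hp
          rw [if_pos ⟨(hiff _).2 h1, (hiff _).2 h2⟩, gridPt_sub, max_norm_gridPt d N (p.1 - p.2),
            Real.mul_rpow hε.le (by positivity)]
          gcongr
          linarith [hle _ h1, hle _ h2]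
      _ = ε ^ (2*d) * ((2 * lam) ^ ζ * (ε ^ β *
            ∑ x ∈ latticeBox d M, ∑ y ∈ latticeBox d M, max ‖x - y‖ 1 ^ β)) := by
          rw [← Finset.mul_sum, ← Finset.mul_sum, Finset.sum_product]
      _ ≤ ε ^ (2*d) * ((2 * lam) ^ ζ * (ε ^ β *
            ((3 ^ d * (lam / ε) ^ d) * (C * (2 * (lam / ε)) ^ (β + d))))) := by
          gcongr
          refine (Finset.sum_le_sum hinner).trans ?_
          rw [Finset.sum_const, nsmul_eq_mul]
          gcongr
          exact (card_latticeBox_le hM1).trans (by gcongr)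
      _ = _ := by
          have hexp : 2 * α + 2 * (d:ℝ) = ζ + d + (β + d) := by rw [hβ]; ring
          rw [hexp, Real.rpow_add hlam0, Real.rpow_add hlam0, Real.rpow_natCast,
            Real.mul_rpow zero_le_two hlam0.le, Real.mul_rpow zero_le_two (by positivity),
            Real.div_rpow hlam0.le hε.le, Real.rpow_add hε, Real.rpow_natCast, div_pow]
          have hεβ : ε ^ β ≠ 0 := by positivity
          field_simp
          ring
  · intro p hp
    refine if_neg fun h => hp ?_
    exact Finset.mem_product.2 ⟨(hiff _).1 h.1, (hiff _).1 h.2⟩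
end
end
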